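/- Let X be a GC_3 set and let ℓ be a 3-node line of X. Then |X_ℓ| = 0 if and only if X has exactly three maximal lines and these three maximal lines intersect ℓ at three distinct nodes of X. -/

import Mathlib

open MvPolynomial

/-- Points of the plane `ℝ²`. -/
abbrev Pt : Type := Fin 2 → ℝ

/-- Bivariate real polynomials. -/
abbrev BPoly : Type := MvPolynomial (Fin 2) ℝ

/-- `X` is an `n`-poised node set: it has `N = (n+1)(n+2)/2` nodes and every
interpolation problem with polynomials of total degree at most `n` has a unique solution. -/
def IsPoised (n : ℕ) (X : Set Pt) : Prop :=
  X.ncard = (n + 1) * (n + 2) / 2 ∧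
  ∀ c : Pt → ℝ, ∃! p : BPoly, p.totalDegree ≤ n ∧ ∀ A ∈ X, eval A p = c A

/-- `p` is an `n`-fundamental polynomial of the node `A` for the node set `X`. -/
def IsFund (n : ℕ) (X : Set Pt) (A : Pt) (p : BPoly) : Prop :=
  p.totalDegree ≤ n ∧ eval A p = 1 ∧ ∀ B ∈ X, B ≠ A → eval B p = 0

/-- `X` is a `GC_n` set: it is `n`-poised and each node has a fundamental polynomial
that is a product of `n` polynomials of degree `1`. -/
def IsGC (n : ℕ) (X : Set Pt) : Prop :=
  IsPoised n X ∧
  ∀ A ∈ X, ∃ p : BPoly, IsFund n X A p ∧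
    ∃ f : Fin n → BPoly, (∀ i, (f i).totalDegree = 1) ∧ p = ∏ i, f i

/-- A line is the zero set of a polynomial of degree exactly `1`. -/
def IsLine (L : Set Pt) : Prop :=
  ∃ f : BPoly, f.totalDegree = 1 ∧ L = {x : Pt | eval x f = 0}

/-- A `k`-node line of `X`: a line passing through exactly `k` nodes of `X`. -/
def IsNodeLine (k : ℕ) (X : Set Pt) (L : Set Pt) : Prop :=
  IsLine L ∧ (X ∩ L).ncard = k

/-- A maximal line of an `n`-poised set `X`: an `(n+1)`-node line. -/
def IsMaxLine (n : ℕ) (X : Set Pt) (L : Set Pt) : Prop :=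
  IsNodeLine (n + 1) X L

/-- The node `A` uses the line `L`: a degree-1 polynomial whose zero set is `L`
divides the `n`-fundamental polynomial of `A` with respect to `X`. -/
def Uses (n : ℕ) (X : Set Pt) (L : Set Pt) (A : Pt) : Prop :=
  ∃ p f : BPoly, IsFund n X A p ∧ f.totalDegree = 1 ∧ L = {x : Pt | eval x f = 0} ∧ f ∣ p

/-- `X_ℓ`: the set of nodes of `X` that use the line `L`. -/
def UseSet (n : ℕ) (X : Set Pt) (L : Set Pt) : Set Pt :=
  {A ∈ X | Uses n X L A}

section LineSystem

variable {α : Type*}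

/-- The lines `a`, `b`, `c` of the family `𝓛` avoid the point `A` and cover the other points
of `X`. -/
structure IsCover (𝓛 : Set (Set α)) (X : Finset α) (A : α) (a b c : Set α) : Prop where
  mem_fst : a ∈ 𝓛
  mem_snd : b ∈ 𝓛
  mem_trd : c ∈ 𝓛
  notMem_fst : A ∉ a
  notMem_snd : A ∉ b
  notMem_trd : A ∉ c
  cover : ∀ B ∈ X, B ≠ A → B ∈ a ∨ B ∈ b ∨ B ∈ c

/-- Ten points with a family of lines that has the incidence properties of a `GC_3` set. -/
structure IsLineSystem (𝓛 : Set (Set α)) (X : Finset α) : Prop where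
  eq_of_mem : ∀ L ∈ 𝓛, ∀ L' ∈ 𝓛, ∀ x y, x ≠ y → x ∈ L → x ∈ L' → y ∈ L → y ∈ L' → L = L'
  card_eq : X.card = 10
  exists_isCover : ∀ A ∈ X, ∃ a b c, IsCover 𝓛 X A a b c
  exists_notMem : ∀ a ∈ 𝓛, ∀ b ∈ 𝓛, ∀ c ∈ 𝓛, ∃ B ∈ X, B ∉ a ∧ B ∉ b ∧ B ∉ c

variable {𝓛 : Set (Set α)} {X : Finset α} {A : α} {a b c L L' M M' : Set α}

namespace IsCover

theorem swap_fst (h : IsCover 𝓛 X A a b c) : IsCover 𝓛 X A b a c :=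
  ⟨h.mem_snd, h.mem_fst, h.mem_trd, h.notMem_snd, h.notMem_fst, h.notMem_trd,
    fun B hB hBA => by have := h.cover B hB hBA; tauto⟩

theorem swap_snd (h : IsCover 𝓛 X A a b c) : IsCover 𝓛 X A a c b :=
  ⟨h.mem_fst, h.mem_trd, h.mem_snd, h.notMem_fst, h.notMem_trd, h.notMem_snd,
    fun B hB hBA => by have := h.cover B hB hBA; tauto⟩

theorem exists_mem_fst (h : IsCover 𝓛 X A a b c) {P : α} (hP : P ∈ X) (hPA : P ≠ A) :
    ∃ a' b' c', IsCover 𝓛 X A a' b' c' ∧ P ∈ a' := by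
  rcases h.cover P hP hPA with hp | hp | hp
  · exact ⟨a, b, c, h, hp⟩
  · exact ⟨b, a, c, h.swap_fst, hp⟩
  · exact ⟨c, a, b, h.swap_snd.swap_fst, hp⟩

end IsCover

open Classical in
/-- The points of `X` that lie on `L`. -/
noncomputable def nodesOn (X : Finset α) (L : Set α) : Finset α := X.filter (· ∈ L)

theorem mem_nodesOn {x : α} : x ∈ nodesOn X L ↔ x ∈ X ∧ x ∈ L := by
  classical simp [nodesOn]

namespace IsLineSystem

theorem card_le_one (h : IsLineSystem 𝓛 X) (hL : L ∈ 𝓛) (hL' : L' ∈ 𝓛) (hne : L ≠ L')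
    {S : Finset α} (hS : ∀ x ∈ S, x ∈ L) (hS' : ∀ x ∈ S, x ∈ L') : S.card ≤ 1 := by
  rw [Finset.card_le_one]
  intro x hx y hy
  by_contra hxy
  exact hne (h.eq_of_mem L hL L' hL' x y hxy (hS x hx) (hS' x hx) (hS y hy) (hS' y hy))

theorem card_le_two (h : IsLineSystem 𝓛 X) (hL : L ∈ 𝓛) (ha : a ∈ 𝓛) (hb : b ∈ 𝓛)
    (hLa : L ≠ a) (hLb : L ≠ b) {S : Finset α} (hS : ∀ x ∈ S, x ∈ L)
    (hc : ∀ x ∈ S, x ∈ a ∨ x ∈ b) : S.card ≤ 2 := by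
  classical
  have h1 := h.card_le_one hL ha hLa (S := S.filter (· ∈ a)) (by simp +contextual [hS]) (by simp)
  have h2 := h.card_le_one hL hb hLb (S := S.filter (· ∈ b)) (by simp +contextual [hS]) (by simp)
  have h3 : S ⊆ S.filter (· ∈ a) ∪ S.filter (· ∈ b) := by
    intro x hx
    have := hc x hx
    simp only [Finset.mem_union, Finset.mem_filter]
    tauto
  have := (Finset.card_le_card h3).trans (Finset.card_union_le _ _)
  omega

theorem card_le_three (h : IsLineSystem 𝓛 X) (hL : L ∈ 𝓛) (ha : a ∈ 𝓛) (hb : b ∈ 𝓛)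
    (hc : c ∈ 𝓛) (hLa : L ≠ a) (hLb : L ≠ b) (hLc : L ≠ c) {S : Finset α}
    (hS : ∀ x ∈ S, x ∈ L) (hcov : ∀ x ∈ S, x ∈ a ∨ x ∈ b ∨ x ∈ c) : S.card ≤ 3 := by
  classical
  have h1 := h.card_le_two hL ha hb hLa hLb (S := S.filter (fun x => x ∈ a ∨ x ∈ b))
    (by simp +contextual [hS]) (by simp)
  have h2 := h.card_le_one hL hc hLc (S := S.filter (· ∈ c)) (by simp +contextual [hS]) (by simp)
  have h3 : S ⊆ S.filter (fun x => x ∈ a ∨ x ∈ b) ∪ S.filter (· ∈ c) := by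
    intro x hx
    have := hcov x hx
    simp only [Finset.mem_union, Finset.mem_filter]
    tauto
  have := (Finset.card_le_card h3).trans (Finset.card_union_le _ _)
  omega

theorem card_nodesOn_le (h : IsLineSystem 𝓛 X) (hL : L ∈ 𝓛) : (nodesOn X L).card ≤ 4 := by
  classical
  by_contra! hlt
  obtain ⟨A, hA⟩ : (nodesOn X L).Nonempty := Finset.card_pos.mp (by omega)
  obtain ⟨hAX, hAL⟩ := mem_nodesOn.mp hA
  obtain ⟨a, b, c, hc⟩ := h.exists_isCover A hAX
  have := h.card_le_three hL hc.mem_fst hc.mem_snd hc.mem_trd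
    (by rintro rfl; exact hc.notMem_fst hAL) (by rintro rfl; exact hc.notMem_snd hAL)
    (by rintro rfl; exact hc.notMem_trd hAL) (S := (nodesOn X L).erase A)
    (fun x hx => (mem_nodesOn.mp (Finset.mem_of_mem_erase hx)).2)
    (fun x hx => hc.cover x (mem_nodesOn.mp (Finset.mem_of_mem_erase hx)).1
      (Finset.ne_of_mem_erase hx))
  rw [Finset.card_erase_of_mem hA] at this
  omega

theorem eq_of_card (h : IsLineSystem 𝓛 X) (hM : M ∈ 𝓛) (hM4 : (nodesOn X M).card = 4)
    (hc : IsCover 𝓛 X A a b c) (hA : A ∉ M) : M = a ∨ M = b ∨ M = c := by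
  by_contra! hne
  have := h.card_le_three hM hc.mem_fst hc.mem_snd hc.mem_trd hne.1 hne.2.1 hne.2.2
    (S := nodesOn X M) (fun x hx => (mem_nodesOn.mp hx).2)
    (fun x hx => hc.cover x (mem_nodesOn.mp hx).1
      (by rintro rfl; exact hA (mem_nodesOn.mp hx).2))
  omega

theorem isCover_max (h : IsLineSystem 𝓛 X) (hM : M ∈ 𝓛) (hM4 : (nodesOn X M).card = 4)
    (hc : IsCover 𝓛 X A a b c) (hA : A ∉ M) : ∃ b' c', IsCover 𝓛 X A M b' c' := by
  rcases h.eq_of_card hM hM4 hc hA with rfl | rfl | rfl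
  exacts [⟨_, _, hc⟩, ⟨_, _, hc.swap_fst⟩, ⟨_, _, hc.swap_snd.swap_fst⟩]

theorem exists_isCover_max (h : IsLineSystem 𝓛 X) (hM : M ∈ 𝓛) (hM4 : (nodesOn X M).card = 4)
    (hAX : A ∈ X) (hA : A ∉ M) : ∃ b' c', IsCover 𝓛 X A M b' c' := by
  obtain ⟨a, b, c, hc⟩ := h.exists_isCover A hAX
  exact h.isCover_max hM hM4 hc hA

theorem isCover_snd_max (h : IsLineSystem 𝓛 X) (hM : M ∈ 𝓛) (hM4 : (nodesOn X M).card = 4)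
    (hc : IsCover 𝓛 X A a b c) (hA : A ∉ M) (hne : M ≠ a) : ∃ c', IsCover 𝓛 X A a M c' := by
  rcases h.eq_of_card hM hM4 hc hA with rfl | rfl | rfl
  exacts [absurd rfl hne, ⟨_, hc⟩, ⟨_, hc.swap_snd⟩]

theorem card_off_le (h : IsLineSystem 𝓛 X) (hM : M ∈ 𝓛) (hM4 : (nodesOn X M).card = 4)
    (hL : L ∈ 𝓛) {S : Finset α} (hSX : S ⊆ X) (hSM : ∀ x ∈ S, x ∉ M) (hSL : ∀ x ∈ S, x ∈ L) :
    S.card ≤ 3 := by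
  classical
  by_contra! hlt
  obtain ⟨A, hA⟩ : S.Nonempty := Finset.card_pos.mp (by omega)
  obtain ⟨b, c, hc⟩ := h.exists_isCover_max hM hM4 (hSX hA) (hSM A hA)
  have := h.card_le_two hL hc.mem_snd hc.mem_trd
    (by rintro rfl; exact hc.notMem_snd (hSL A hA))
    (by rintro rfl; exact hc.notMem_trd (hSL A hA)) (S := S.erase A)
    (fun x hx => hSL x (Finset.mem_of_mem_erase hx))
    (fun x hx => (hc.cover x (hSX (Finset.mem_of_mem_erase hx))
      (Finset.ne_of_mem_erase hx)).resolve_left (hSM x (Finset.mem_of_mem_erase hx)))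
  rw [Finset.card_erase_of_mem hA] at this
  omega

theorem exists_mem_inter (h : IsLineSystem 𝓛 X) (hM : M ∈ 𝓛) (hM4 : (nodesOn X M).card = 4)
    (hM' : M' ∈ 𝓛) (hM'4 : (nodesOn X M').card = 4) : ∃ P ∈ X, P ∈ M ∧ P ∈ M' := by
  by_contra! hno
  have := h.card_off_le hM hM4 hM' (S := nodesOn X M')
    (fun x hx => (mem_nodesOn.mp hx).1)
    (fun x hx hxM => hno x (mem_nodesOn.mp hx).1 hxM (mem_nodesOn.mp hx).2)
    (fun x hx => (mem_nodesOn.mp hx).2)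
  omega

/-- Without four-point lines, the three lines of a cover have three points each and are
disjoint. -/
theorem isCover_partition (h : IsLineSystem 𝓛 X)
    (hno : ∀ L ∈ 𝓛, (nodesOn X L).card ≤ 3) (hA : A ∈ X) (hc : IsCover 𝓛 X A a b c) :
    (nodesOn X a).card = 3 ∧ ∀ x ∈ X, x ∈ a → x ∉ b ∧ x ∉ c := by
  classical
  have h1 := hno a hc.mem_fst
  have h2 := hno b hc.mem_snd
  have h3 := hno c hc.mem_trd
  have hsub : X.erase A ⊆ nodesOn X a ∪ (nodesOn X b ∪ nodesOn X c) := by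
    intro x hx
    have hxX := Finset.mem_of_mem_erase hx
    have := hc.cover x hxX (Finset.ne_of_mem_erase hx)
    simp only [Finset.mem_union, mem_nodesOn]
    tauto
  have h4 := Finset.card_le_card hsub
  rw [Finset.card_erase_of_mem hA, h.card_eq] at h4
  have h5 := Finset.card_union_add_card_inter (nodesOn X a) (nodesOn X b ∪ nodesOn X c)
  have h6 := Finset.card_union_le (nodesOn X b) (nodesOn X c)
  refine ⟨by omega, fun x hx hxa => ?_⟩
  have h7 : nodesOn X a ∩ (nodesOn X b ∪ nodesOn X c) = ∅ :=
    Finset.card_eq_zero.mp (by omega)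
  constructor <;> intro hxb
  all_goals
    have : x ∈ nodesOn X a ∩ (nodesOn X b ∪ nodesOn X c) := by
      simp only [Finset.mem_inter, Finset.mem_union, mem_nodesOn]
      tauto
    simp [h7] at this

theorem isCover_unique_of_card_le (h : IsLineSystem 𝓛 X)
    (hno : ∀ L ∈ 𝓛, (nodesOn X L).card ≤ 3) {B : α} (hA : A ∈ X) (hB : B ∈ X) {b' c' : Set α}
    (hcA : IsCover 𝓛 X A a b c) (hcB : IsCover 𝓛 X B a b' c') : A = B := by
  classical
  by_contra hAB
  wlog hBb : B ∈ b generalizing b c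
  · exact this hcA.swap_snd
      (by have := hcA.cover B hB (Ne.symm hAB); have := hcB.notMem_fst; tauto)
  wlog hAb : A ∈ b' generalizing b' c'
  · exact this hcB.swap_snd
      (by have := hcB.cover A hA hAB; have := hcA.notMem_fst; tauto)
  have hb := h.isCover_partition hno hA hcA.swap_fst
  have hc := h.isCover_partition hno hA hcA.swap_snd.swap_fst
  have hcc : c = c' := by
    by_contra hne
    have := h.card_le_two hcA.mem_trd hcB.mem_snd hcB.mem_trd
      (by rintro rfl; exact hcA.notMem_trd hAb) hne (S := nodesOn X c)
      (fun x hx => (mem_nodesOn.mp hx).2)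
      (fun x hx => by
        obtain ⟨hxX, hxc⟩ := mem_nodesOn.mp hx
        refine (hcB.cover x hxX ?_).resolve_left (hc.2 x hxX hxc).1
        rintro rfl
        exact (hb.2 x hxX hBb).2 hxc)
    omega
  have := h.card_le_one hcA.mem_snd hcB.mem_snd
      (by rintro rfl; exact hcA.notMem_snd hAb) (S := (nodesOn X b).erase B)
      (fun x hx => (mem_nodesOn.mp (Finset.mem_of_mem_erase hx)).2)
      (fun x hx => by
        obtain ⟨hxX, hxb⟩ := mem_nodesOn.mp (Finset.mem_of_mem_erase hx)
        have h1 := hcB.cover x hxX (Finset.ne_of_mem_erase hx)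
        have h2 := hb.2 x hxX hxb
        rw [← hcc] at h1
        tauto)
  rw [Finset.card_erase_of_mem (mem_nodesOn.mpr ⟨hB, hBb⟩)] at this
  omega

theorem exists_card_eq_four (h : IsLineSystem 𝓛 X) : ∃ M ∈ 𝓛, (nodesOn X M).card = 4 := by
  classical
  by_contra! hne
  have hno : ∀ L ∈ 𝓛, (nodesOn X L).card ≤ 3 := fun L hL => by
    have := h.card_nodesOn_le hL
    have := hne L hL
    omega
  obtain ⟨P, hP⟩ : X.Nonempty := Finset.card_pos.mp (by rw [h.card_eq]; omega)
  have hex : ∀ B ∈ X.erase P, ∃ a, (∃ b c, IsCover 𝓛 X B a b c) ∧ P ∈ a := fun B hB => by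
    obtain ⟨a, b, c, hc⟩ := h.exists_isCover B (Finset.mem_of_mem_erase hB)
    obtain ⟨a', b', c', hc', hPa⟩ := hc.exists_mem_fst hP (Finset.ne_of_mem_erase hB).symm
    exact ⟨a', ⟨b', c', hc'⟩, hPa⟩
  choose! g hg hPg using hex
  have hsub : (X.erase P).biUnion (fun B => (nodesOn X (g B)).erase P) ⊆ X.erase P := by
    intro x hx
    simp only [Finset.mem_biUnion, Finset.mem_erase, mem_nodesOn] at hx ⊢
    obtain ⟨B, -, hxP, hxX, -⟩ := hx
    exact ⟨hxP, hxX⟩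
  have hdisj : ∀ B ∈ X.erase P, ∀ C ∈ X.erase P, B ≠ C →
      Disjoint ((nodesOn X (g B)).erase P) ((nodesOn X (g C)).erase P) := by
    intro B hB C hC hBC
    rw [Finset.disjoint_left]
    intro x hx hx'
    simp only [Finset.mem_erase, mem_nodesOn] at hx hx'
    obtain ⟨b, c, hcB⟩ := hg B hB
    obtain ⟨b', c', hcC⟩ := hg C hC
    have hgg := h.eq_of_mem _ hcB.mem_fst _ hcC.mem_fst x P hx.1 hx.2.2 hx'.2.2
      (hPg B hB) (hPg C hC)
    rw [← hgg] at hcC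
    exact hBC (h.isCover_unique_of_card_le hno (Finset.mem_of_mem_erase hB)
      (Finset.mem_of_mem_erase hC) hcB hcC)
  have hle := Finset.card_le_card hsub
  rw [Finset.card_biUnion hdisj, Finset.sum_congr rfl (g := fun _ => 2), Finset.sum_const,
    Finset.card_erase_of_mem hP, h.card_eq] at hle
  · simp at hle
  · intro B hB
    obtain ⟨b, c, hcB⟩ := hg B hB
    rw [Finset.card_erase_of_mem (mem_nodesOn.mpr ⟨hP, hPg B hB⟩),
      (h.isCover_partition hno (Finset.mem_of_mem_erase hB) hcB).1]

theorem exists_mem_max (h : IsLineSystem 𝓛 X) (hM : M ∈ 𝓛) (hM4 : (nodesOn X M).card = 4)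
    {m : α} (hm : m ∈ X) (hmM : m ∈ M) (hc : IsCover 𝓛 X m a b c) :
    ∃ j ∈ X, j ∈ M ∧ j ∈ a ∧ j ∉ b ∧ j ≠ m := by
  classical
  by_contra! hno
  have := h.card_le_two hM hc.mem_snd hc.mem_trd
    (by rintro rfl; exact hc.notMem_snd hmM) (by rintro rfl; exact hc.notMem_trd hmM)
    (S := (nodesOn X M).erase m)
    (fun x hx => (mem_nodesOn.mp (Finset.mem_of_mem_erase hx)).2)
    (fun x hx => by
      obtain ⟨hxX, hxM⟩ := mem_nodesOn.mp (Finset.mem_of_mem_erase hx)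
      have hxm := Finset.ne_of_mem_erase hx
      have h1 := hc.cover x hxX hxm
      have h2 := hno x hxX hxM
      tauto)
  rw [Finset.card_erase_of_mem (mem_nodesOn.mpr ⟨hm, hmM⟩)] at this
  omega

/-- In a triangle of lines off the four-point line `M`, at most one side misses `X ∩ M`. -/
theorem exists_mem_side (h : IsLineSystem 𝓛 X) (hM : M ∈ 𝓛) (hM4 : (nodesOn X M).card = 4)
    {L₁ L₂ L₃ : Set α} {p q r x y z : α} (h₁ : L₁ ∈ 𝓛) (h₂ : L₂ ∈ 𝓛) (h₃ : L₃ ∈ 𝓛)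
    (h₁₂ : L₁ ≠ L₂) (h₁₃ : L₁ ≠ L₃) (h₂₃ : L₂ ≠ L₃)
    (hX : p ∈ X ∧ q ∈ X ∧ r ∈ X ∧ x ∈ X ∧ y ∈ X ∧ z ∈ X)
    (hYM : p ∉ M ∧ q ∉ M ∧ r ∉ M ∧ x ∉ M ∧ y ∉ M ∧ z ∉ M)
    (hp : p ∈ L₁ ∧ p ∈ L₂) (hq : q ∈ L₁ ∧ q ∈ L₃) (hr : r ∈ L₂ ∧ r ∈ L₃)
    (hx : x ∈ L₁ ∧ x ≠ p ∧ x ≠ q) (hy : y ∈ L₂ ∧ y ≠ p ∧ y ≠ r) (hz : z ∈ L₃ ∧ z ≠ q ∧ z ≠ r)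
    (hpq : p ≠ q) (hpr : p ≠ r) (hqr : q ≠ r) :
    ∃ m ∈ X, m ∈ M ∧ (m ∈ L₁ ∨ m ∈ L₂) := by
  classical
  have U := h.eq_of_mem
  by_contra! hno
  have hxy : x ≠ y := by
    rintro rfl
    exact h₁₂ (U _ h₁ _ h₂ x p hx.2.1 hx.1 hy.1 hp.1 hp.2)
  have key : ∀ m ∈ X, m ∈ M →
      (∃ j ∈ X, ∃ k ∈ X, ∃ c ∈ 𝓛, c ≠ M ∧ x ∈ c ∧ y ∈ c ∧ j ∈ M ∧ k ∈ M ∧ j ≠ m ∧ k ≠ m ∧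
        j ≠ k ∧ j ∈ L₃ ∧ k ∈ c) ∨
      (∃ a b c, IsCover 𝓛 X m a b c ∧ p ∈ a ∧ z ∈ a ∧ q ∈ b ∧ y ∈ b ∧ x ∈ c ∧ r ∈ c) := by
    intro m hm hmM
    have hne : ∀ w, w ∉ M → w ≠ m := by rintro w hw rfl; exact hw hmM
    have hside : ∀ {a b c}, IsCover 𝓛 X m a b c → a ≠ L₁ ∧ a ≠ L₂ := by
      intro a b c hc
      obtain ⟨j, hj, hjM, hja, -⟩ := h.exists_mem_max hM hM4 hm hmM hc
      obtain ⟨hj1, hj2⟩ := hno j hj hjM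
      constructor <;> rintro rfl <;> contradiction
    obtain ⟨a₀, b₀, c₀, hc₀⟩ := h.exists_isCover m hm
    obtain ⟨a, b, c, hc, hpa⟩ := hc₀.exists_mem_fst hX.1 (hne p hYM.1)
    clear hc₀ a₀ b₀ c₀
    have hqa : q ∉ a := fun hqa => (hside hc).1 (U _ hc.mem_fst _ h₁ p q hpq hpa hp.1 hqa hq.1)
    wlog hqb : q ∈ b generalizing b c
    · exact this c b hc.swap_snd
        (by have := hc.cover q hX.2.1 (hne q hYM.2.1); tauto)
    have ha := hside hc
    have hb := hside hc.swap_fst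
    have hcc := hside hc.swap_snd.swap_fst
    have hxa : x ∉ a := fun hxa => ha.1 (U _ hc.mem_fst _ h₁ p x hx.2.1.symm hpa hp.1 hxa hx.1)
    have hxb : x ∉ b := fun hxb => hb.1 (U _ hc.mem_snd _ h₁ q x hx.2.2.symm hqb hq.1 hxb hx.1)
    have hxc : x ∈ c := by have := hc.cover x hX.2.2.2.1 (hne x hYM.2.2.2.1); tauto
    have hra : r ∉ a := fun hra => ha.2 (U _ hc.mem_fst _ h₂ p r hpr hpa hp.2 hra hr.1)
    have hya : y ∉ a := fun hya => ha.2 (U _ hc.mem_fst _ h₂ p y hy.2.1.symm hpa hp.2 hya hy.1)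
    rcases (hc.cover r hX.2.2.1 (hne r hYM.2.2.1)).resolve_left hra with hrb | hrc
    · left
      have hb3 : b = L₃ := U _ hc.mem_snd _ h₃ q r hqr hqb hq.2 hrb hr.2
      have hyb : y ∉ b := fun hyb => hb.2 (U _ hc.mem_snd _ h₂ r y hy.2.2.symm hrb hr.1 hyb hy.1)
      have hyc : y ∈ c := by have := hc.cover y hX.2.2.2.2.1 (hne y hYM.2.2.2.2.1); tauto
      obtain ⟨j, hj, hjM, hjb, hjc, hjm⟩ :=
        h.exists_mem_max hM hM4 hm hmM hc.swap_fst.swap_snd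
      obtain ⟨k, hk, hkM, hkc, -, hkm⟩ :=
        h.exists_mem_max hM hM4 hm hmM hc.swap_snd.swap_fst
      refine ⟨j, hj, k, hk, c, hc.mem_trd, ?_, hxc, hyc, hjM, hkM, hjm, hkm, ?_, hb3 ▸ hjb, hkc⟩
      · rintro rfl; exact hc.notMem_trd hmM
      · rintro rfl; exact hjc hkc
    · right
      have hyc : y ∉ c := fun hyc => hcc.2 (U _ hc.mem_trd _ h₂ r y hy.2.2.symm hrc hr.1 hyc hy.1)
      have hyb : y ∈ b := by have := hc.cover y hX.2.2.2.2.1 (hne y hYM.2.2.2.2.1); tauto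
      have hzb : z ∉ b := fun hzb => by
        have hb3 : b = L₃ := U _ hc.mem_snd _ h₃ q z hz.2.1.symm hqb hq.2 hzb hz.1
        exact h₂₃ (U _ h₂ _ h₃ r y hy.2.2.symm hr.1 hr.2 hy.1 (hb3 ▸ hyb))
      have hzc : z ∉ c := fun hzc => by
        have hc3 : c = L₃ := U _ hc.mem_trd _ h₃ r z hz.2.2.symm hrc hr.2 hzc hz.1
        exact h₁₃ (U _ h₁ _ h₃ q x hx.2.2.symm hq.1 hq.2 hx.1 (hc3 ▸ hxc))
      have hza : z ∈ a := by have := hc.cover z hX.2.2.2.2.2 (hne z hYM.2.2.2.2.2); tauto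
      exact ⟨a, b, c, hc, hpa, hza, hqb, hyb, hxc, hrc⟩
  have hpz : p ≠ z := by
    rintro rfl
    exact h₁₃ (U _ h₁ _ h₃ p q hpq hp.1 hz.1 hq.1 hq.2)
  have hqy : q ≠ y := by
    rintro rfl
    exact h₁₂ (U _ h₁ _ h₂ p q hpq hp.1 hp.2 hq.1 hy.1)
  have hxr : x ≠ r := by
    rintro rfl
    exact h₁₂ (U _ h₁ _ h₂ p x hpr hp.1 hp.2 hx.1 hr.1)
  have hII : ∀ m ∈ X, ∀ m' ∈ X, m ≠ m' → ∀ {a b c a' b' c'},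
      IsCover 𝓛 X m a b c ∧ p ∈ a ∧ z ∈ a ∧ q ∈ b ∧ y ∈ b ∧ x ∈ c ∧ r ∈ c →
      IsCover 𝓛 X m' a' b' c' ∧ p ∈ a' ∧ z ∈ a' ∧ q ∈ b' ∧ y ∈ b' ∧ x ∈ c' ∧ r ∈ c' → False := by
    rintro m - m' hm' hmm' a b c a' b' c' ⟨hc, h1, h2, h3, h4, h5, h6⟩
      ⟨hc', h1', h2', h3', h4', h5', h6'⟩
    obtain rfl : a = a' := U _ hc.mem_fst _ hc'.mem_fst p z hpz h1 h1' h2 h2'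
    obtain rfl : b = b' := U _ hc.mem_snd _ hc'.mem_snd q y hqy h3 h3' h4 h4'
    obtain rfl : c = c' := U _ hc.mem_trd _ hc'.mem_trd x r hxr h5 h5' h6 h6'
    rcases hc.cover m' hm' hmm'.symm with hh | hh | hh
    exacts [hc'.notMem_fst hh, hc'.notMem_snd hh, hc'.notMem_trd hh]
  have hL₃M : L₃ ≠ M := by rintro rfl; exact hYM.2.1 hq.2
  by_cases hI : ∃ j ∈ X, ∃ k ∈ X, ∃ c ∈ 𝓛, c ≠ M ∧ x ∈ c ∧ y ∈ c ∧ j ∈ M ∧ k ∈ M ∧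
      j ≠ k ∧ j ∈ L₃ ∧ k ∈ c
  · obtain ⟨j, hj, k, hk, c, hcL, hcM, hxc, hyc, hjM, hkM, hjk, hj3, hkc⟩ := hI
    have huniq : ∀ j' k' c', c' ∈ 𝓛 → x ∈ c' → y ∈ c' → j' ∈ M → k' ∈ M → j' ∈ L₃ → k' ∈ c' →
        j' = j ∧ k' = k := by
      intro j' k' c' hcL' hxc' hyc' hjM' hkM' hj3' hkc'
      obtain rfl : c = c' := U _ hcL _ hcL' x y hxy hxc hxc' hyc hyc'
      constructor
      · by_contra hne
        exact hL₃M (U _ h₃ _ hM j' j hne hj3' hjM' hj3 hjM)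
      · by_contra hne
        exact hcM (U _ hcL _ hM k' k hne hkc' hkM' hkc hkM)
    rcases key j hj hjM with ⟨j', -, k', -, c', hc', -, h1, h2, h3, h4, h5, h6, -, h7, h8⟩ | hII₁
    · exact h5 (huniq j' k' c' hc' h1 h2 h3 h4 h7 h8).1
    rcases key k hk hkM with ⟨j', -, k', -, c', hc', -, h1, h2, h3, h4, h5, h6, -, h7, h8⟩ | hII₂
    · exact h6 (huniq j' k' c' hc' h1 h2 h3 h4 h7 h8).2
    obtain ⟨_, _, _, hII₁⟩ := hII₁
    obtain ⟨_, _, _, hII₂⟩ := hII₂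
    exact hII j hj k hk hjk hII₁ hII₂
  · have hall : ∀ m ∈ X, m ∈ M →
        ∃ a b c, IsCover 𝓛 X m a b c ∧ p ∈ a ∧ z ∈ a ∧ q ∈ b ∧ y ∈ b ∧ x ∈ c ∧ r ∈ c := by
      intro m hm hmM
      refine (key m hm hmM).resolve_left ?_
      rintro ⟨j, hj, k, hk, c, hcL, hcM, h1, h2, h3, h4, -, -, h5, h6, h7⟩
      exact hI ⟨j, hj, k, hk, c, hcL, hcM, h1, h2, h3, h4, h5, h6, h7⟩
    obtain ⟨m, hm, m', hm', hne⟩ := Finset.one_lt_card.mp (by omega : 1 < (nodesOn X M).card)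
    rw [mem_nodesOn] at hm hm'
    obtain ⟨_, _, _, hII₁⟩ := hall m hm.1 hm.2
    obtain ⟨_, _, _, hII₂⟩ := hall m' hm'.1 hm'.2
    exact hII m hm.1 m' hm'.1 hne hII₁ hII₂

theorem exists_three_max (h : IsLineSystem 𝓛 X) :
    ∃ M₁ ∈ 𝓛, ∃ M₂ ∈ 𝓛, ∃ M₃ ∈ 𝓛, M₁ ≠ M₂ ∧ M₁ ≠ M₃ ∧ M₂ ≠ M₃ ∧
      (nodesOn X M₁).card = 4 ∧ (nodesOn X M₂).card = 4 ∧ (nodesOn X M₃).card = 4 := by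
  classical
  have U := h.eq_of_mem
  obtain ⟨M, hM, hM4⟩ := h.exists_card_eq_four
  set Y := X \ nodesOn X M with hY
  have hmemY : ∀ {w}, w ∈ Y ↔ w ∈ X ∧ w ∉ M := by
    intro w
    simp only [hY, Finset.mem_sdiff, mem_nodesOn]
    tauto
  have hY6 : Y.card = 6 := by
    rw [hY, Finset.card_sdiff_of_subset (fun w hw => (mem_nodesOn.mp hw).1), h.card_eq, hM4]
  have hle : ∀ L ∈ 𝓛, (nodesOn Y L).card ≤ 3 := fun L hL =>
    h.card_off_le hM hM4 hL (fun w hw => (hmemY.mp (mem_nodesOn.mp hw).1).1)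
      (fun w hw => (hmemY.mp (mem_nodesOn.mp hw).1).2) (fun w hw => (mem_nodesOn.mp hw).2)
  have hex : ∀ A ∈ Y, ∃ L ∈ 𝓛, A ∉ L ∧ (nodesOn Y L).card = 3 := by
    intro A hA
    obtain ⟨b, c, hc⟩ := h.exists_isCover_max hM hM4 (hmemY.mp hA).1 (hmemY.mp hA).2
    have hsub : Y.erase A ⊆ nodesOn Y b ∪ nodesOn Y c := by
      intro w hw
      have hwY := Finset.mem_of_mem_erase hw
      have := hc.cover w (hmemY.mp hwY).1 (Finset.ne_of_mem_erase hw)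
      have := (hmemY.mp hwY).2
      simp only [Finset.mem_union, mem_nodesOn]
      tauto
    have h4 := (Finset.card_le_card hsub).trans (Finset.card_union_le _ _)
    rw [Finset.card_erase_of_mem hA, hY6] at h4
    have hb := hle b hc.mem_snd
    have hcc := hle c hc.mem_trd
    by_cases hb3 : (nodesOn Y b).card = 3
    · exact ⟨b, hc.mem_snd, hc.notMem_snd, hb3⟩
    · exact ⟨c, hc.mem_trd, hc.notMem_trd, by omega⟩
  have hmeet : ∀ L ∈ 𝓛, ∀ L' ∈ 𝓛, (nodesOn Y L).card = 3 → (nodesOn Y L').card = 3 →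
      ∃ w ∈ Y, w ∈ L ∧ w ∈ L' := by
    intro L hL L' hL' h3 h3'
    by_contra! hno
    obtain ⟨B, hB, hBM, hBL, hBL'⟩ := h.exists_notMem M hM L hL L' hL'
    have hdisj : Disjoint (nodesOn Y L) (nodesOn Y L') := by
      rw [Finset.disjoint_left]
      intro w hw hw'
      rw [mem_nodesOn] at hw hw'
      exact hno w hw.1 hw.2 hw'.2
    have hsub : nodesOn Y L ∪ nodesOn Y L' ⊆ Y.erase B := by
      intro w hw
      simp only [Finset.mem_union, mem_nodesOn, Finset.mem_erase] at hw ⊢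
      refine ⟨?_, by tauto⟩
      rintro rfl
      tauto
    have h4 := Finset.card_le_card hsub
    rw [Finset.card_union_of_disjoint hdisj, Finset.card_erase_of_mem (hmemY.mpr ⟨hB, hBM⟩)] at h4
    omega
  have hthird : ∀ L, (nodesOn Y L).card = 3 → ∀ u v, ∃ w ∈ Y, w ∈ L ∧ w ≠ u ∧ w ≠ v := by
    intro L h3 u v
    obtain ⟨w, hw, hw'⟩ := Finset.exists_mem_notMem_of_card_lt_card
      (s := {u, v}) (t := nodesOn Y L) (by have := Finset.card_le_two (a := u) (b := v); omega)
    rw [mem_nodesOn] at hw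
    simp only [Finset.mem_insert, Finset.mem_singleton, not_or] at hw'
    exact ⟨w, hw.1, hw.2, hw'⟩
  have hmax : ∀ L ∈ 𝓛, (nodesOn Y L).card = 3 → ∀ m ∈ X, m ∈ M → m ∈ L →
      (nodesOn X L).card = 4 := by
    intro L hL h3 m hm hmM hmL
    have hsub : insert m (nodesOn Y L) ⊆ nodesOn X L := by
      intro w hw
      simp only [Finset.mem_insert, mem_nodesOn, hmemY] at hw ⊢
      rcases hw with rfl | hw
      exacts [⟨hm, hmL⟩, ⟨hw.1.1, hw.2⟩]
    have h4 := Finset.card_le_card hsub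
    rw [Finset.card_insert_of_notMem (by simp [mem_nodesOn, hmemY, hmM])] at h4
    have := h.card_nodesOn_le hL
    omega
  obtain ⟨A, hA⟩ : Y.Nonempty := Finset.card_pos.mp (by omega)
  obtain ⟨L₁, h₁, -, hL₁⟩ := hex A hA
  obtain ⟨B, hBY, hB₁, -⟩ := hthird L₁ hL₁ A A
  obtain ⟨L₂, h₂, hB₂, hL₂⟩ := hex B hBY
  have h₁₂ : L₁ ≠ L₂ := by rintro rfl; exact hB₂ hB₁
  obtain ⟨p, hpY, hp₁, hp₂⟩ := hmeet L₁ h₁ L₂ h₂ hL₁ hL₂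
  obtain ⟨L₃, h₃, hp₃, hL₃⟩ := hex p hpY
  have h₁₃ : L₁ ≠ L₃ := by rintro rfl; exact hp₃ hp₁
  have h₂₃ : L₂ ≠ L₃ := by rintro rfl; exact hp₃ hp₂
  obtain ⟨q, hqY, hq₁, hq₃⟩ := hmeet L₁ h₁ L₃ h₃ hL₁ hL₃
  obtain ⟨r, hrY, hr₂, hr₃⟩ := hmeet L₂ h₂ L₃ h₃ hL₂ hL₃
  obtain ⟨x, hxY, hx, hxp, hxq⟩ := hthird L₁ hL₁ p q
  obtain ⟨y, hyY, hy, hyp, hyr⟩ := hthird L₂ hL₂ p r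
  obtain ⟨z, hzY, hz, hzq, hzr⟩ := hthird L₃ hL₃ q r
  have hpq : p ≠ q := by rintro rfl; exact hp₃ hq₃
  have hpr : p ≠ r := by rintro rfl; exact hp₃ hr₃
  have hqr : q ≠ r := by
    rintro rfl
    exact h₁₂ (U _ h₁ _ h₂ p q hpq hp₁ hp₂ hq₁ hr₂)
  rw [hmemY] at hpY hqY hrY hxY hyY hzY
  have hM₁ : M ≠ L₁ := by rintro rfl; exact hpY.2 hp₁
  have hM₂ : M ≠ L₂ := by rintro rfl; exact hpY.2 hp₂
  have hM₃ : M ≠ L₃ := by rintro rfl; exact hqY.2 hq₃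
  have s₁₂ := h.exists_mem_side hM hM4 h₁ h₂ h₃ h₁₂ h₁₃ h₂₃
    (p := p) (q := q) (r := r) (x := x) (y := y) (z := z)
    (by tauto) (by tauto) (by tauto) (by tauto) (by tauto) (by tauto) (by tauto) (by tauto)
    hpq hpr hqr
  have s₁₃ := h.exists_mem_side hM hM4 h₁ h₃ h₂ h₁₃ h₁₂ h₂₃.symm
    (p := q) (q := p) (r := r) (x := x) (y := z) (z := y)
    (by tauto) (by tauto) (by tauto) (by tauto) (by tauto) (by tauto) (by tauto) (by tauto)
    hpq.symm hqr hpr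
  have s₂₃ := h.exists_mem_side hM hM4 h₂ h₃ h₁ h₂₃ h₁₂.symm h₁₃.symm
    (p := r) (q := p) (r := q) (x := y) (y := z) (z := x)
    (by tauto) (by tauto) (by tauto) (by tauto) (by tauto) (by tauto) (by tauto) (by tauto)
    hpr.symm hqr.symm hpq
  have hor : ∀ L ∈ 𝓛, ∀ L' ∈ 𝓛, (nodesOn Y L).card = 3 → (nodesOn Y L').card = 3 →
      (∃ m ∈ X, m ∈ M ∧ (m ∈ L ∨ m ∈ L')) →
      (nodesOn X L).card = 4 ∨ (nodesOn X L').card = 4 := by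
    rintro L hL L' hL' h3 h3' ⟨m, hm, hmM, hmL | hmL⟩
    exacts [Or.inl (hmax L hL h3 m hm hmM hmL), Or.inr (hmax L' hL' h3' m hm hmM hmL)]
  have t₁₂ := hor L₁ h₁ L₂ h₂ hL₁ hL₂ s₁₂
  have t₁₃ := hor L₁ h₁ L₃ h₃ hL₁ hL₃ s₁₃
  have t₂₃ := hor L₂ h₂ L₃ h₃ hL₂ hL₃ s₂₃
  by_cases m₁ : (nodesOn X L₁).card = 4
  · rcases t₂₃ with m₂ | m₃
    · exact ⟨M, hM, L₁, h₁, L₂, h₂, hM₁, hM₂, h₁₂, hM4, m₁, m₂⟩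
    · exact ⟨M, hM, L₁, h₁, L₃, h₃, hM₁, hM₃, h₁₃, hM4, m₁, m₃⟩
  · exact ⟨M, hM, L₂, h₂, L₃, h₃, hM₂, hM₃, h₂₃, hM4, t₁₂.resolve_left m₁, t₁₃.resolve_left m₁⟩

/-- A four-point line that does not meet the three-point line `ℓ` in `X` makes `ℓ` used. -/
theorem exists_isCover_of_disjoint (h : IsLineSystem 𝓛 X) {ℓ : Set α} (hℓ : ℓ ∈ 𝓛)
    (hℓ3 : (nodesOn X ℓ).card = 3) (hM : M ∈ 𝓛) (hM4 : (nodesOn X M).card = 4)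
    (hdisj : ∀ x ∈ X, x ∈ ℓ → x ∉ M) : ∃ A ∈ X, ∃ b c, IsCover 𝓛 X A ℓ b c := by
  classical
  obtain ⟨A, hAX, hA⟩ := Finset.exists_mem_notMem_of_card_lt_card
    (s := nodesOn X M ∪ nodesOn X ℓ) (t := X)
    (by have := Finset.card_union_le (nodesOn X M) (nodesOn X ℓ); have := h.card_eq; omega)
  simp only [Finset.mem_union, mem_nodesOn, not_or, not_and] at hA
  obtain ⟨b, c, hc⟩ := h.exists_isCover_max hM hM4 hAX (hA.1 hAX)
  refine ⟨A, hAX, ?_⟩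
  by_cases hb : ℓ = b
  · exact ⟨M, c, hb ▸ hc.swap_fst⟩
  by_cases hcc : ℓ = c
  · exact ⟨M, b, hcc ▸ hc.swap_snd.swap_fst⟩
  have := h.card_le_two hℓ hc.mem_snd hc.mem_trd hb hcc (S := nodesOn X ℓ)
    (fun x hx => (mem_nodesOn.mp hx).2)
    (fun x hx => by
      obtain ⟨hxX, hxℓ⟩ := mem_nodesOn.mp hx
      exact (hc.cover x hxX (by rintro rfl; exact hA.2 hAX hxℓ)).resolve_left (hdisj x hxX hxℓ))
  omega

/-- Two four-point lines that meet on the three-point line `ℓ` make `ℓ` used. -/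
theorem exists_isCover_of_concurrent (h : IsLineSystem 𝓛 X) {ℓ : Set α} (hℓ : ℓ ∈ 𝓛)
    (hℓ3 : (nodesOn X ℓ).card = 3) (hM : M ∈ 𝓛) (hM4 : (nodesOn X M).card = 4)
    (hM' : M' ∈ 𝓛) (hM'4 : (nodesOn X M').card = 4) (hne : M ≠ M') {P : α} (hP : P ∈ X)
    (hPℓ : P ∈ ℓ) (hPM : P ∈ M) (hPM' : P ∈ M') : ∃ A ∈ X, ∃ b c, IsCover 𝓛 X A ℓ b c := by
  classical
  have hℓM : ℓ ≠ M := by rintro rfl; omega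
  have hℓM' : ℓ ≠ M' := by rintro rfl; omega
  obtain ⟨A, hAX, hAM, hAM', hAℓ⟩ := h.exists_notMem M hM M' hM' ℓ hℓ
  obtain ⟨b₀, c₀, hc₀⟩ := h.exists_isCover_max hM hM4 hAX hAM
  obtain ⟨c, hc⟩ := h.isCover_snd_max hM' hM'4 hc₀ hAM' hne.symm
  have hcard : 1 < ((nodesOn X ℓ).erase P).card := by
    rw [Finset.card_erase_of_mem (mem_nodesOn.mpr ⟨hP, hPℓ⟩)]
    omega
  have hcov : ∀ x ∈ (nodesOn X ℓ).erase P, x ∈ ℓ ∧ x ∈ c := by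
    intro x hx
    obtain ⟨hxX, hxℓ⟩ := mem_nodesOn.mp (Finset.mem_of_mem_erase hx)
    have hxP := Finset.ne_of_mem_erase hx
    refine ⟨hxℓ, ?_⟩
    rcases hc.cover x hxX (by rintro rfl; exact hAℓ hxℓ) with hxM | hxM | hxc
    · exact absurd (h.eq_of_mem _ hℓ _ hM x P hxP hxℓ hxM hPℓ hPM) hℓM
    · exact absurd (h.eq_of_mem _ hℓ _ hM' x P hxP hxℓ hxM hPℓ hPM') hℓM'
    · exact hxc
  obtain ⟨x, hx, y, hy, hxy⟩ := Finset.one_lt_card.mp hcard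
  obtain rfl := h.eq_of_mem _ hℓ _ hc.mem_trd x y hxy (hcov x hx).1 (hcov x hx).2
    (hcov y hy).1 (hcov y hy).2
  exact ⟨A, hAX, M, M', hc.swap_snd.swap_fst⟩

end IsLineSystem

/-- The three-point line `ℓ` meets the three four-point lines of the system in the three
distinct points `A₁`, `A₂`, `A₃`. -/
structure IsTransversal (𝓛 : Set (Set α)) (X : Finset α) (ℓ M₁ M₂ M₃ : Set α)
    (A₁ A₂ A₃ : α) : Prop where
  mem : ℓ ∈ 𝓛
  card_eq : (nodesOn X ℓ).card = 3
  mem₁ : M₁ ∈ 𝓛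
  mem₂ : M₂ ∈ 𝓛
  mem₃ : M₃ ∈ 𝓛
  card₁ : (nodesOn X M₁).card = 4
  card₂ : (nodesOn X M₂).card = 4
  card₃ : (nodesOn X M₃).card = 4
  ne₁₂ : M₁ ≠ M₂
  ne₁₃ : M₁ ≠ M₃
  ne₂₃ : M₂ ≠ M₃
  eq_of_card : ∀ M ∈ 𝓛, (nodesOn X M).card = 4 → M = M₁ ∨ M = M₂ ∨ M = M₃
  pt_ne₁₂ : A₁ ≠ A₂
  pt_ne₁₃ : A₁ ≠ A₃
  pt_ne₂₃ : A₂ ≠ A₃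
  pt₁ : A₁ ∈ X ∧ A₁ ∈ ℓ ∧ A₁ ∈ M₁
  pt₂ : A₂ ∈ X ∧ A₂ ∈ ℓ ∧ A₂ ∈ M₂
  pt₃ : A₃ ∈ X ∧ A₃ ∈ ℓ ∧ A₃ ∈ M₃

namespace IsTransversal

variable {ℓ M₁ M₂ M₃ : Set α} {A₁ A₂ A₃ : α}

theorem swap₁₂ (t : IsTransversal 𝓛 X ℓ M₁ M₂ M₃ A₁ A₂ A₃) :
    IsTransversal 𝓛 X ℓ M₂ M₁ M₃ A₂ A₁ A₃ :=
  ⟨t.mem, t.card_eq, t.mem₂, t.mem₁, t.mem₃, t.card₂, t.card₁, t.card₃, t.ne₁₂.symm, t.ne₂₃,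
    t.ne₁₃, fun M hM hM4 => by have := t.eq_of_card M hM hM4; tauto,
    t.pt_ne₁₂.symm, t.pt_ne₂₃, t.pt_ne₁₃, t.pt₂, t.pt₁, t.pt₃⟩

theorem swap₂₃ (t : IsTransversal 𝓛 X ℓ M₁ M₂ M₃ A₁ A₂ A₃) :
    IsTransversal 𝓛 X ℓ M₁ M₃ M₂ A₁ A₃ A₂ :=
  ⟨t.mem, t.card_eq, t.mem₁, t.mem₃, t.mem₂, t.card₁, t.card₃, t.card₂, t.ne₁₃, t.ne₁₂,
    t.ne₂₃.symm, fun M hM hM4 => by have := t.eq_of_card M hM hM4; tauto,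
    t.pt_ne₁₃, t.pt_ne₁₂, t.pt_ne₂₃.symm, t.pt₁, t.pt₃, t.pt₂⟩

theorem ne_fst (t : IsTransversal 𝓛 X ℓ M₁ M₂ M₃ A₁ A₂ A₃) : ℓ ≠ M₁ := by
  rintro rfl
  have := t.card_eq
  have := t.card₁
  omega

theorem notMem_snd (h : IsLineSystem 𝓛 X) (t : IsTransversal 𝓛 X ℓ M₁ M₂ M₃ A₁ A₂ A₃) :
    A₁ ∉ M₂ := fun hA =>
  t.swap₁₂.ne_fst (h.eq_of_mem _ t.mem _ t.mem₂ A₁ A₂ t.pt_ne₁₂ t.pt₁.2.1 hA t.pt₂.2.1 t.pt₂.2.2)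

theorem eq_of_mem_line (h : IsLineSystem 𝓛 X) (t : IsTransversal 𝓛 X ℓ M₁ M₂ M₃ A₁ A₂ A₃) {B : α}
    (hBℓ : B ∈ ℓ) (hBM : B ∈ M₁) : B = A₁ := by
  by_contra hne
  exact t.ne_fst (h.eq_of_mem _ t.mem _ t.mem₁ B A₁ hne hBℓ hBM t.pt₁.2.1 t.pt₁.2.2)

theorem notMem_line (t : IsTransversal 𝓛 X ℓ M₁ M₂ M₃ A₁ A₂ A₃) {B : α} (hB : B ∈ X)
    (h₁ : B ∉ M₁) (h₂ : B ∉ M₂) (h₃ : B ∉ M₃) : B ∉ ℓ := by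
  classical
  intro hBℓ
  have hsub : {B, A₁, A₂, A₃} ⊆ nodesOn X ℓ := by
    intro w hw
    simp only [Finset.mem_insert, Finset.mem_singleton] at hw
    rw [mem_nodesOn]
    rcases hw with rfl | rfl | rfl | rfl
    exacts [⟨hB, hBℓ⟩, ⟨t.pt₁.1, t.pt₁.2.1⟩, ⟨t.pt₂.1, t.pt₂.2.1⟩, ⟨t.pt₃.1, t.pt₃.2.1⟩]
  have h4 := Finset.card_le_card hsub
  have h₁' : B ≠ A₁ := by rintro rfl; exact h₁ t.pt₁.2.2
  have h₂' : B ≠ A₂ := by rintro rfl; exact h₂ t.pt₂.2.2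
  have h₃' : B ≠ A₃ := by rintro rfl; exact h₃ t.pt₃.2.2
  rw [t.card_eq, Finset.card_insert_of_notMem (by simp [h₁', h₂', h₃']),
    Finset.card_insert_of_notMem (by simp [t.pt_ne₁₂, t.pt_ne₁₃]),
    Finset.card_pair t.pt_ne₂₃] at h4
  omega

/-- A line with four points of `X` is one of the three four-point lines, so it contains no
point off these. -/
theorem not_collinear (h : IsLineSystem 𝓛 X) (t : IsTransversal 𝓛 X ℓ M₁ M₂ M₃ A₁ A₂ A₃)
    {O B C D : α} (hO : O ∈ X ∧ O ∉ M₁ ∧ O ∉ M₂ ∧ O ∉ M₃) (hB : B ∈ X) (hC : C ∈ X) (hD : D ∈ X)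
    (hOB : O ≠ B) (hOC : O ≠ C) (hOD : O ≠ D) (hBC : B ≠ C) (hBD : B ≠ D) (hCD : C ≠ D)
    (hL : L ∈ 𝓛) (hOL : O ∈ L) (hBL : B ∈ L) (hCL : C ∈ L) (hDL : D ∈ L) : False := by
  classical
  have hsub : {O, B, C, D} ⊆ nodesOn X L := by
    intro w hw
    simp only [Finset.mem_insert, Finset.mem_singleton] at hw
    rw [mem_nodesOn]
    rcases hw with rfl | rfl | rfl | rfl
    exacts [⟨hO.1, hOL⟩, ⟨hB, hBL⟩, ⟨hC, hCL⟩, ⟨hD, hDL⟩]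
  have h4 := Finset.card_le_card hsub
  rw [Finset.card_insert_of_notMem (by simp [hOB, hOC, hOD]),
    Finset.card_insert_of_notMem (by simp [hBC, hBD]), Finset.card_pair hCD] at h4
  have := h.card_nodesOn_le hL
  rcases t.eq_of_card L hL (by omega) with rfl | rfl | rfl
  exacts [hO.2.1 hOL, hO.2.2.1 hOL, hO.2.2.2 hOL]

theorem not_concurrent (h : IsLineSystem 𝓛 X) (t : IsTransversal 𝓛 X ℓ M₁ M₂ M₃ A₁ A₂ A₃) {P : α}
    (hP : P ∈ X) (h₁ : P ∈ M₁) (h₂ : P ∈ M₂) (h₃ : P ∈ M₃) : False := by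
  classical
  obtain ⟨O, hO, hO₁, hO₂, hO₃⟩ := h.exists_notMem _ t.mem₁ _ t.mem₂ _ t.mem₃
  have hmem : ∀ {M w}, w ∈ (nodesOn X M).erase P ↔ w ≠ P ∧ w ∈ X ∧ w ∈ M := by
    intro M w
    rw [Finset.mem_erase, mem_nodesOn]
  have hdisj : ∀ M ∈ 𝓛, ∀ M' ∈ 𝓛, M ≠ M' → P ∈ M → P ∈ M' →
      Disjoint ((nodesOn X M).erase P) ((nodesOn X M').erase P) := by
    intro M hM M' hM' hne hPM hPM'
    rw [Finset.disjoint_left]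
    intro w hw hw'
    rw [hmem] at hw hw'
    exact hne (h.eq_of_mem _ hM _ hM' w P hw.1 hw.2.2 hw'.2.2 hPM hPM')
  have hcard : ∀ M, P ∈ M → (nodesOn X M).card = 4 → ((nodesOn X M).erase P).card = 3 := by
    intro M hPM h4
    rw [Finset.card_erase_of_mem (mem_nodesOn.mpr ⟨hP, hPM⟩), h4]
  have hsub : (nodesOn X M₁).erase P ∪ ((nodesOn X M₂).erase P ∪ (nodesOn X M₃).erase P) ⊆
      (X.erase P).erase O := by
    intro w hw
    simp only [Finset.mem_union, hmem] at hw
    simp only [Finset.mem_erase]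
    refine ⟨?_, by tauto, by tauto⟩
    rintro rfl
    tauto
  have hle := Finset.card_le_card hsub
  have hOP : O ≠ P := by rintro rfl; exact hO₁ h₁
  rw [Finset.card_union_of_disjoint (Finset.disjoint_union_right.mpr
      ⟨hdisj _ t.mem₁ _ t.mem₂ t.ne₁₂ h₁ h₂, hdisj _ t.mem₁ _ t.mem₃ t.ne₁₃ h₁ h₃⟩),
    Finset.card_union_of_disjoint (hdisj _ t.mem₂ _ t.mem₃ t.ne₂₃ h₂ h₃),
    hcard _ h₁ t.card₁, hcard _ h₂ t.card₂, hcard _ h₃ t.card₃,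
    Finset.card_erase_of_mem (Finset.mem_erase.mpr ⟨hOP, hO⟩), Finset.card_erase_of_mem hP,
    h.card_eq] at hle
  omega

variable {b c : Set α}

theorem not_isCover_of_notMem_snd_trd (h : IsLineSystem 𝓛 X)
    (t : IsTransversal 𝓛 X ℓ M₁ M₂ M₃ A₁ A₂ A₃) (hc : IsCover 𝓛 X A ℓ b c)
    (h₂ : A ∉ M₂) (h₃ : A ∉ M₃) : False := by
  obtain ⟨c', hc'⟩ := h.isCover_snd_max t.mem₂ t.card₂ hc h₂ t.swap₁₂.ne_fst.symm
  rcases h.eq_of_card t.mem₃ t.card₃ hc' h₃ with he | he | rfl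
  · exact t.swap₂₃.swap₁₂.ne_fst he.symm
  · exact t.ne₂₃ he.symm
  by_cases h₁ : A ∈ M₁
  · obtain ⟨O, hO, hO₁, hO₂, hO₃⟩ := h.exists_notMem _ t.mem₁ _ t.mem₂ _ t.mem₃
    rcases hc'.cover O hO (by rintro rfl; exact hO₁ h₁) with h' | h' | h'
    exacts [t.notMem_line hO hO₁ hO₂ hO₃ h', hO₂ h', hO₃ h']
  · rcases h.eq_of_card t.mem₁ t.card₁ hc' h₁ with he | he | he
    exacts [t.ne_fst he.symm, t.ne₁₂ he, t.ne₁₃ he]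

theorem exists_line_of_corner (h : IsLineSystem 𝓛 X) (t : IsTransversal 𝓛 X ℓ M₁ M₂ M₃ A₁ A₂ A₃)
    {Q B₁ B₂ B₃ O : α} {r : Set α} (hQ : Q ∈ X ∧ Q ∈ M₁ ∧ Q ∉ M₂ ∧ Q ∈ M₃)
    (hB₁ : B₁ ∈ X ∧ B₁ ∈ M₁ ∧ B₁ ∉ M₂ ∧ B₁ ∉ M₃ ∧ B₁ ∉ ℓ)
    (hB₂ : B₂ ∈ X ∧ B₂ ∉ M₁ ∧ B₂ ∈ M₂ ∧ B₂ ∉ M₃ ∧ B₂ ∉ ℓ)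
    (hB₃ : B₃ ∈ X ∧ B₃ ∉ M₁ ∧ B₃ ∉ M₂ ∧ B₃ ∈ M₃ ∧ B₃ ∉ ℓ)
    (hO : O ∈ X ∧ O ∉ M₁ ∧ O ∉ M₂ ∧ O ∉ M₃) (hr : r ∈ 𝓛) (hB₁r : B₁ ∈ r) (hB₂r : B₂ ∈ r)
    (hOr : O ∈ r) : ∃ s ∈ 𝓛, A₁ ∈ s ∧ B₃ ∈ s ∧ O ∈ s := by
  have U := h.eq_of_mem
  have hOℓ := t.notMem_line hO.1 hO.2.1 hO.2.2.1 hO.2.2.2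
  have hA₁M₂ := t.notMem_snd h
  have hA₃M₁ := t.swap₂₃.swap₁₂.notMem_snd h
  have hA₃M₂ := t.swap₂₃.swap₁₂.swap₂₃.notMem_snd h
  have hA₁M₃ := t.swap₂₃.notMem_snd h
  obtain ⟨s₀, t₀, hc₀⟩ := h.exists_isCover_max t.mem₂ t.card₂ hQ.1 hQ.2.2.1
  obtain ⟨s, u, hc, hA₁s⟩ : ∃ s u, IsCover 𝓛 X Q M₂ s u ∧ A₁ ∈ s := by
    rcases hc₀.cover A₁ t.pt₁.1 (by rintro rfl; exact hA₁M₃ hQ.2.2.2) with h' | h' | h'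
    exacts [absurd h' hA₁M₂, ⟨_, _, hc₀, h'⟩, ⟨_, _, hc₀.swap_snd, h'⟩]
  have cov : ∀ {w}, w ∈ X → w ∉ M₂ → w ≠ Q → w ∈ s ∨ w ∈ u := fun hw hw₂ hwQ =>
    (hc.cover _ hw hwQ).resolve_left hw₂
  have hB₁A₁ : B₁ ≠ A₁ := by rintro rfl; exact hB₁.2.2.2.2 t.pt₁.2.1
  have hB₃A₃ : B₃ ≠ A₃ := by rintro rfl; exact hB₃.2.2.2.2 t.pt₃.2.1
  have hB₁O : B₁ ≠ O := by rintro rfl; exact hO.2.1 hB₁.2.1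
  have hB₂O : B₂ ≠ O := by rintro rfl; exact hO.2.2.1 hB₂.2.2.1
  have hB₃O : B₃ ≠ O := by rintro rfl; exact hO.2.2.2 hB₃.2.2.2.1
  have hA₃O : A₃ ≠ O := by rintro rfl; exact hO.2.2.2 t.pt₃.2.2
  have hB₁B₂ : B₁ ≠ B₂ := by rintro rfl; exact hB₁.2.2.1 hB₂.2.2.1
  have hB₁B₃ : B₁ ≠ B₃ := by rintro rfl; exact hB₁.2.2.2.1 hB₃.2.2.2.1
  have hB₂B₃ : B₂ ≠ B₃ := by rintro rfl; exact hB₂.2.2.2.1 hB₃.2.2.2.1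
  have hB₁A₃ : B₁ ≠ A₃ := by rintro rfl; exact hB₁.2.2.2.1 t.pt₃.2.2
  have hB₂A₃ : B₂ ≠ A₃ := by rintro rfl; exact hB₂.2.2.2.1 t.pt₃.2.2
  have hB₁s : B₁ ∉ s := fun h' => hc.notMem_snd
    (U _ hc.mem_snd _ t.mem₁ B₁ A₁ hB₁A₁ h' hB₁.2.1 hA₁s t.pt₁.2.2 ▸ hQ.2.1)
  have hB₁u : B₁ ∈ u := (cov hB₁.1 hB₁.2.2.1
    (by rintro rfl; exact hB₁.2.2.2.1 hQ.2.2.2)).resolve_left hB₁s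
  have hnot : ∀ L ∈ 𝓛, Q ∉ L → A₃ ∈ L → B₃ ∉ L := fun L hL hQL hA h' =>
    hQL (U _ hL _ t.mem₃ B₃ A₃ hB₃A₃ h' hB₃.2.2.2.1 hA t.pt₃.2.2 ▸ hQ.2.2.2)
  have hA₃ := cov t.pt₃.1 hA₃M₂ (by rintro rfl; exact hA₃M₁ hQ.2.1)
  have hB₃' := cov hB₃.1 hB₃.2.2.1 (by rintro rfl; exact hB₃.2.1 hQ.2.1)
  have hO' := cov hO.1 hO.2.2.1 (by rintro rfl; exact hO.2.1 hQ.2.1)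
  have hur : O ∈ u → u = r := fun h' => U _ hc.mem_trd _ hr B₁ O hB₁O hB₁u hB₁r h' hOr
  rcases hA₃ with hA₃s | hA₃u
  · have hsℓ : s = ℓ := U _ hc.mem_snd _ t.mem A₁ A₃ t.pt_ne₁₃ hA₁s t.pt₁.2.1 hA₃s t.pt₃.2.1
    have hB₃u := hB₃'.resolve_left (hnot s hc.mem_snd hc.notMem_snd hA₃s)
    have hOu := hO'.resolve_left (by rwa [hsℓ])
    exact (t.not_collinear h hO hB₁.1 hB₂.1 hB₃.1 hB₁O.symm hB₂O.symm hB₃O.symm hB₁B₂ hB₁B₃ hB₂B₃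
      hr hOr hB₁r hB₂r (hur hOu ▸ hB₃u)).elim
  · have hB₃s := hB₃'.resolve_right (hnot u hc.mem_trd hc.notMem_trd hA₃u)
    refine ⟨s, hc.mem_snd, hA₁s, hB₃s, hO'.resolve_right fun hOu => ?_⟩
    exact t.not_collinear h hO hB₁.1 hB₂.1 t.pt₃.1 hB₁O.symm hB₂O.symm hA₃O.symm hB₁B₂ hB₁A₃ hB₂A₃
      hr hOr hB₁r hB₂r (hur hOu ▸ hA₃u)

theorem exists_other (h : IsLineSystem 𝓛 X) (t : IsTransversal 𝓛 X ℓ M₁ M₂ M₃ A₁ A₂ A₃) {P Q : α}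
    (hP : P ∈ M₁ ∧ P ∈ M₂) (hQ : Q ∈ M₁ ∧ Q ∈ M₃) :
    ∃ B, B ∈ X ∧ B ∈ M₁ ∧ B ∉ M₂ ∧ B ∉ M₃ ∧ B ∉ ℓ := by
  classical
  obtain ⟨B, hB, hB'⟩ := Finset.exists_mem_notMem_of_card_lt_card
    (s := {P, Q, A₁}) (t := nodesOn X M₁)
    (by have := Finset.card_le_three (a := P) (b := Q) (c := A₁); have := t.card₁; omega)
  simp only [Finset.mem_insert, Finset.mem_singleton, not_or] at hB'
  obtain ⟨hBX, hBM⟩ := mem_nodesOn.mp hB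
  refine ⟨B, hBX, hBM, fun h' => ?_, fun h' => ?_, fun h' => hB'.2.2 (t.eq_of_mem_line h h' hBM)⟩
  · exact t.ne₁₂ (h.eq_of_mem _ t.mem₁ _ t.mem₂ B P hB'.1 hBM h' hP.1 hP.2)
  · exact t.ne₁₃ (h.eq_of_mem _ t.mem₁ _ t.mem₃ B Q hB'.2.1 hBM h' hQ.1 hQ.2)

theorem not_isCover_of_mem_fst_snd (h : IsLineSystem 𝓛 X)
    (t : IsTransversal 𝓛 X ℓ M₁ M₂ M₃ A₁ A₂ A₃) (hA : A ∈ X) (hc : IsCover 𝓛 X A ℓ b c)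
    (h₁ : A ∈ M₁) (h₂ : A ∈ M₂) : False := by
  have U := h.eq_of_mem
  have h₃ : A ∉ M₃ := fun h₃ => t.not_concurrent h hA h₁ h₂ h₃
  obtain ⟨r, hr⟩ := h.isCover_snd_max t.mem₃ t.card₃ hc h₃ t.swap₂₃.swap₁₂.ne_fst.symm
  obtain ⟨Q, hQ, hQ₁, hQ₃⟩ := h.exists_mem_inter t.mem₁ t.card₁ t.mem₃ t.card₃
  obtain ⟨R, hR, hR₂, hR₃⟩ := h.exists_mem_inter t.mem₂ t.card₂ t.mem₃ t.card₃
  have hQ₂ : Q ∉ M₂ := fun hQ₂ => t.not_concurrent h hQ hQ₁ hQ₂ hQ₃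
  have hR₁ : R ∉ M₁ := fun hR₁ => t.not_concurrent h hR hR₁ hR₂ hR₃
  obtain ⟨B₁, hB₁⟩ := t.exists_other h ⟨h₁, h₂⟩ ⟨hQ₁, hQ₃⟩
  obtain ⟨B₂, hB₂⟩ := t.swap₁₂.exists_other h ⟨h₂, h₁⟩ ⟨hR₂, hR₃⟩
  obtain ⟨B₃, hB₃⟩ := t.swap₂₃.swap₁₂.exists_other h ⟨hQ₃, hQ₁⟩ ⟨hR₃, hR₂⟩
  obtain ⟨O, hO, hO₁, hO₂, hO₃⟩ := h.exists_notMem _ t.mem₁ _ t.mem₂ _ t.mem₃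
  have hOℓ := t.notMem_line hO hO₁ hO₂ hO₃
  have hmem : ∀ {w}, w ∈ X → w ≠ A → w ∉ ℓ → w ∉ M₃ → w ∈ r := by
    intro w hw hwA hwℓ hw₃
    have := hr.cover w hw hwA
    tauto
  have hB₁r : B₁ ∈ r := hmem hB₁.1 (by rintro rfl; exact hB₁.2.2.1 h₂) hB₁.2.2.2.2 hB₁.2.2.2.1
  have hB₂r : B₂ ∈ r := hmem hB₂.1 (by rintro rfl; exact hB₂.2.2.1 h₁) hB₂.2.2.2.2 hB₂.2.2.2.1
  have hOr : O ∈ r := hmem hO (by rintro rfl; exact hO₁ h₁) hOℓ hO₃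
  obtain ⟨s, hs, hA₁s, hB₃s, hOs⟩ := t.exists_line_of_corner h ⟨hQ, hQ₁, hQ₂, hQ₃⟩ hB₁
    (by tauto) (by tauto) ⟨hO, hO₁, hO₂, hO₃⟩ hr.mem_trd hB₁r hB₂r hOr
  obtain ⟨s', hs', hA₂s, hB₃s', hOs'⟩ := t.swap₁₂.exists_line_of_corner h ⟨hR, hR₂, hR₁, hR₃⟩
    hB₂ (by tauto) (by tauto) ⟨hO, hO₂, hO₁, hO₃⟩ hr.mem_trd hB₂r hB₁r hOr
  obtain rfl := U _ hs _ hs' B₃ O (by rintro rfl; exact hO₃ hB₃.2.1) hB₃s hB₃s' hOs hOs'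
  obtain rfl := U _ hs _ t.mem A₁ A₂ t.pt_ne₁₂ hA₁s t.pt₁.2.1 hA₂s t.pt₂.2.1
  exact hOℓ hOs

theorem not_isCover (h : IsLineSystem 𝓛 X) (t : IsTransversal 𝓛 X ℓ M₁ M₂ M₃ A₁ A₂ A₃)
    (hA : A ∈ X) : ¬ IsCover 𝓛 X A ℓ b c := by
  intro hc
  by_cases h₁ : A ∈ M₁ <;> by_cases h₂ : A ∈ M₂
  · exact t.not_isCover_of_mem_fst_snd h hA hc h₁ h₂
  · by_cases h₃ : A ∈ M₃
    · exact t.swap₂₃.not_isCover_of_mem_fst_snd h hA hc h₁ h₃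
    · exact t.not_isCover_of_notMem_snd_trd h hc h₂ h₃
  · by_cases h₃ : A ∈ M₃
    · exact t.swap₁₂.swap₂₃.not_isCover_of_mem_fst_snd h hA hc h₂ h₃
    · exact t.swap₁₂.not_isCover_of_notMem_snd_trd h hc h₁ h₃
  · exact t.swap₂₃.swap₁₂.not_isCover_of_notMem_snd_trd h hc h₁ h₂

end IsTransversal

/-- The combinatorial form of the theorem: a three-point line belongs to no cover iff the
system has exactly three four-point lines and they meet it in three distinct points. -/
theorem IsLineSystem.forall_not_isCover_iff (h : IsLineSystem 𝓛 X) {ℓ : Set α} (hℓ : ℓ ∈ 𝓛)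
    (hℓ3 : (nodesOn X ℓ).card = 3) :
    (∀ A ∈ X, ∀ b c, ¬ IsCover 𝓛 X A ℓ b c) ↔
      ∃ M₁ M₂ M₃ A₁ A₂ A₃, IsTransversal 𝓛 X ℓ M₁ M₂ M₃ A₁ A₂ A₃ := by
  classical
  refine ⟨fun hno => ?_, ?_⟩
  · have hmeet : ∀ M ∈ 𝓛, (nodesOn X M).card = 4 → ∃ A, A ∈ X ∧ A ∈ ℓ ∧ A ∈ M := by
      intro M hM hM4
      by_contra! hdisj
      obtain ⟨A, hA, b, c, hc⟩ := h.exists_isCover_of_disjoint hℓ hℓ3 hM hM4 hdisj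
      exact hno A hA b c hc
    have hne : ∀ M ∈ 𝓛, (nodesOn X M).card = 4 → ∀ M' ∈ 𝓛, (nodesOn X M').card = 4 →
        ∀ P, P ∈ X ∧ P ∈ ℓ ∧ P ∈ M → P ∈ M' → M = M' := by
      intro M hM hM4 M' hM' hM'4 P hP hPM'
      by_contra hMM'
      obtain ⟨A, hA, b, c, hc⟩ := h.exists_isCover_of_concurrent hℓ hℓ3 hM hM4 hM' hM'4 hMM'
        hP.1 hP.2.1 hP.2.2 hPM'
      exact hno A hA b c hc
    obtain ⟨M₁, h₁, M₂, h₂, M₃, h₃, n₁₂, n₁₃, n₂₃, c₁, c₂, c₃⟩ := h.exists_three_max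
    obtain ⟨A₁, hA₁⟩ := hmeet M₁ h₁ c₁
    obtain ⟨A₂, hA₂⟩ := hmeet M₂ h₂ c₂
    obtain ⟨A₃, hA₃⟩ := hmeet M₃ h₃ c₃
    have p₁₂ : A₁ ≠ A₂ := by rintro rfl; exact n₁₂ (hne M₁ h₁ c₁ M₂ h₂ c₂ _ hA₁ hA₂.2.2)
    have p₁₃ : A₁ ≠ A₃ := by rintro rfl; exact n₁₃ (hne M₁ h₁ c₁ M₃ h₃ c₃ _ hA₁ hA₃.2.2)
    have p₂₃ : A₂ ≠ A₃ := by rintro rfl; exact n₂₃ (hne M₂ h₂ c₂ M₃ h₃ c₃ _ hA₂ hA₃.2.2)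
    have hsub : {A₁, A₂, A₃} ⊆ nodesOn X ℓ := by
      intro w hw
      simp only [Finset.mem_insert, Finset.mem_singleton] at hw
      rw [mem_nodesOn]
      rcases hw with rfl | rfl | rfl <;> tauto
    have heq : {A₁, A₂, A₃} = nodesOn X ℓ := Finset.eq_of_subset_of_card_le hsub (by
      rw [hℓ3, Finset.card_insert_of_notMem (by simp [p₁₂, p₁₃]), Finset.card_pair p₂₃])
    refine ⟨M₁, M₂, M₃, A₁, A₂, A₃, hℓ, hℓ3, h₁, h₂, h₃, c₁, c₂, c₃, n₁₂, n₁₃, n₂₃, ?_,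
      p₁₂, p₁₃, p₂₃, hA₁, hA₂, hA₃⟩
    intro M hM hM4
    obtain ⟨B, hB⟩ := hmeet M hM hM4
    have hBmem : B ∈ ({A₁, A₂, A₃} : Finset α) := heq ▸ mem_nodesOn.mpr ⟨hB.1, hB.2.1⟩
    simp only [Finset.mem_insert, Finset.mem_singleton] at hBmem
    rcases hBmem with rfl | rfl | rfl
    · exact Or.inl (hne M hM hM4 M₁ h₁ c₁ _ hB hA₁.2.2)
    · exact Or.inr (Or.inl (hne M hM hM4 M₂ h₂ c₂ _ hB hA₂.2.2))
    · exact Or.inr (Or.inr (hne M hM hM4 M₃ h₃ c₃ _ hB hA₃.2.2))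
  · rintro ⟨M₁, M₂, M₃, A₁, A₂, A₃, t⟩ A hA b c
    exact t.not_isCover h hA

end LineSystem

section GC

/-- A bivariate polynomial of degree `1` is a nonconstant affine function. -/
theorem exists_eval_eq_of_totalDegree_eq_one {f : BPoly} (hf : f.totalDegree = 1) :
    ∃ a b c : ℝ, (a ≠ 0 ∨ b ≠ 0) ∧ ∀ x : Pt, eval x f = a * x 0 + b * x 1 + c := by
  have hdeg : ∀ m : Fin 2 →₀ ℕ, coeff m f ≠ 0 → m 0 + m 1 ≤ 1 := by
    intro m hm
    have := le_totalDegree (mem_support_iff.mpr hm)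
    rw [hf, Finsupp.sum_fintype _ _ (fun _ => rfl), Fin.sum_univ_two] at this
    exact this
  have hrep : f = C (coeff (Finsupp.single 0 1) f) * X 0 + C (coeff (Finsupp.single 1 1) f) * X 1
      + C (coeff 0 f) := by
    ext m
    simp only [coeff_add, coeff_C_mul, coeff_X, coeff_C]
    have h01 : (Finsupp.single 0 1 : Fin 2 →₀ ℕ) ≠ Finsupp.single 1 1 := by
      simp [Finsupp.single_left_inj]
    have h0 : ∀ i : Fin 2, (0 : Fin 2 →₀ ℕ) ≠ Finsupp.single i 1 := fun i =>
      (Finsupp.single_ne_zero.mpr one_ne_zero).symm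
    by_cases hm : coeff m f = 0
    · simp +contextual [hm]
    · have := hdeg m hm
      have hcases : m = Finsupp.single 0 1 ∨ m = Finsupp.single 1 1 ∨ m = 0 := by
        have h3 : (m 0 = 1 ∧ m 1 = 0) ∨ (m 0 = 0 ∧ m 1 = 1) ∨ (m 0 = 0 ∧ m 1 = 0) := by omega
        rcases h3 with h3 | h3 | h3
        · left; ext i; fin_cases i <;> simp [h3]
        · right; left; ext i; fin_cases i <;> simp [h3]
        · right; right; ext i; fin_cases i <;> simp [h3]
      rcases hcases with rfl | rfl | rfl <;> simp [h01, h01.symm, h0]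
  refine ⟨coeff (Finsupp.single 0 1) f, coeff (Finsupp.single 1 1) f, coeff 0 f, ?_, fun x => ?_⟩
  swap
  · conv_lhs => rw [hrep]
    simp
  by_contra! h0
  rw [h0.1, h0.2] at hrep
  simp only [map_zero, zero_mul, zero_add] at hrep
  rw [hrep, totalDegree_C] at hf
  omega

theorem IsLine.exists_eq {L : Set Pt} (hL : IsLine L) :
    ∃ a b c : ℝ, (a ≠ 0 ∨ b ≠ 0) ∧ ∀ x : Pt, x ∈ L ↔ a * x 0 + b * x 1 + c = 0 := by
  obtain ⟨f, hf, rfl⟩ := hL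
  obtain ⟨a, b, c, hab, h⟩ := exists_eval_eq_of_totalDegree_eq_one hf
  exact ⟨a, b, c, hab, fun x => by rw [Set.mem_ofPred_eq, h]⟩

theorem IsLine.eq_of_mem {L L' : Set Pt} (hL : IsLine L) (hL' : IsLine L') {x y : Pt}
    (hxy : x ≠ y) (hx : x ∈ L) (hx' : x ∈ L') (hy : y ∈ L) (hy' : y ∈ L') : L = L' := by
  have key : ∀ {K K' : Set Pt}, IsLine K → IsLine K' → x ∈ K → x ∈ K' → y ∈ K → y ∈ K' →
      K ⊆ K' := by
    intro K K' hK hK' hx hx' hy hy' z hz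
    obtain ⟨a, b, c, hab, h⟩ := hK.exists_eq
    obtain ⟨a', b', c', -, h'⟩ := hK'.exists_eq
    rw [h] at hx hy hz
    rw [h'] at hx' hy' ⊢
    have hd : x 0 - y 0 ≠ 0 ∨ x 1 - y 1 ≠ 0 := by
      by_contra! hd
      refine hxy (funext fun i => ?_)
      fin_cases i
      · exact sub_eq_zero.mp hd.1
      · exact sub_eq_zero.mp hd.2
    have e : a * (x 0 - y 0) + b * (x 1 - y 1) = 0 := by linear_combination hx - hy
    have e' : a' * (x 0 - y 0) + b' * (x 1 - y 1) = 0 := by linear_combination hx' - hy'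
    have ez : a * (z 0 - y 0) + b * (z 1 - y 1) = 0 := by linear_combination hz - hy
    have hdet : a' * b = a * b' := by
      rcases hd with hd | hd
      · refine mul_right_cancel₀ hd ?_
        linear_combination b * e' - b' * e
      · refine mul_right_cancel₀ hd ?_
        linear_combination a' * e - a * e'
    rcases hab with ha | hb
    · refine mul_left_cancel₀ ha ?_
      linear_combination a * hy' + a' * ez - (z 1 - y 1) * hdet
    · refine mul_left_cancel₀ hb ?_
      linear_combination b * hy' + b' * ez + (z 0 - y 0) * hdet
  exact (key hL hL' hx hx' hy hy').antisymm (key hL' hL hx' hx hy' hy)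

theorem IsLine.exists_injective {L : Set Pt} (hL : IsLine L) :
    ∃ g : ℝ → Pt, Function.Injective g ∧ ∀ s, g s ∈ L := by
  obtain ⟨a, b, c, hab, h⟩ := hL.exists_eq
  have hpos : a ^ 2 + b ^ 2 ≠ 0 := by
    rcases hab with ha | hb <;> positivity
  refine ⟨fun s => ![-(a * c) / (a ^ 2 + b ^ 2) + b * s, -(b * c) / (a ^ 2 + b ^ 2) - a * s],
    ?_, fun s => ?_⟩
  · intro s s' hs
    have h0 := congrFun hs 0
    have h1 := congrFun hs 1
    simp only [Matrix.cons_val_zero, Matrix.cons_val_one] at h0 h1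
    rcases hab with ha | hb
    · exact mul_left_cancel₀ ha (by linarith)
    · exact mul_left_cancel₀ hb (by linarith)
  · rw [h]
    simp only [Matrix.cons_val_zero, Matrix.cons_val_one]
    field_simp
    ring

/-- A line inside the union of three lines is one of them. -/
theorem IsLine.eq_of_subset {L a b c : Set Pt} (hL : IsLine L) (ha : IsLine a) (hb : IsLine b)
    (hc : IsLine c) (hsub : ∀ x ∈ L, x ∈ a ∨ x ∈ b ∨ x ∈ c) : L = a ∨ L = b ∨ L = c := by
  obtain ⟨g, hg, hgL⟩ := hL.exists_injective
  by_contra! hne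
  have hsingle : ∀ K, IsLine K → L ≠ K → (g ⁻¹' K).Subsingleton := by
    intro K hK hLK s hs s' hs'
    by_contra hss
    exact hLK (hL.eq_of_mem hK (hg.ne hss) (hgL s) hs (hgL s') hs')
  refine Set.infinite_univ (α := ℝ) ((((hsingle a ha hne.1).finite).union
    (((hsingle b hb hne.2.1).finite).union ((hsingle c hc hne.2.2).finite))).subset ?_)
  intro s _
  exact hsub (g s) (hgL s)

theorem IsFund.unique {n : ℕ} {X : Set Pt} (hX : IsPoised n X) {A : Pt} {p q : BPoly}
    (hp : IsFund n X A p) (hq : IsFund n X A q) : p = q := by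
  classical
  refine (hX.2 fun B => if B = A then 1 else 0).unique ⟨hp.1, fun B hB => ?_⟩
    ⟨hq.1, fun B hB => ?_⟩
  · split_ifs with h
    · rw [h, hp.2.1]
    · exact hp.2.2 B hB h
  · split_ifs with h
    · rw [h, hq.2.1]
    · exact hq.2.2 B hB h

variable {X : Set Pt} {S : Finset Pt}

theorem totalDegree_mul_three_le {f g h : BPoly} (hf : f.totalDegree = 1) (hg : g.totalDegree = 1)
    (hh : h.totalDegree = 1) : (f * g * h).totalDegree ≤ 3 := by
  have h1 := totalDegree_mul (f * g) h
  have h2 := totalDegree_mul f g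
  omega

theorem IsPoised.exists_notMem (hX : IsPoised 3 X) {a b c : Set Pt} (ha : IsLine a)
    (hb : IsLine b) (hc : IsLine c) : ∃ B ∈ X, B ∉ a ∧ B ∉ b ∧ B ∉ c := by
  obtain ⟨f, hf, rfl⟩ := ha
  obtain ⟨g, hg, rfl⟩ := hb
  obtain ⟨h, hh, rfl⟩ := hc
  by_contra! hno
  have hzero : f * g * h = 0 := (hX.2 fun _ => 0).unique
    ⟨totalDegree_mul_three_le hf hg hh, fun B hB => by
      have := hno B hB
      simp only [Set.mem_ofPred_eq] at this
      rw [map_mul, map_mul, mul_eq_zero, mul_eq_zero]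
      tauto⟩
    ⟨by simp, by simp⟩
  rw [mul_eq_zero, mul_eq_zero] at hzero
  rcases hzero with (rfl | rfl) | rfl <;> simp at hf hg hh

theorem IsGC.exists_isFund (hX : IsGC 3 X) {A : Pt} (hA : A ∈ X) :
    ∃ f g h : BPoly, f.totalDegree = 1 ∧ g.totalDegree = 1 ∧ h.totalDegree = 1 ∧
      IsFund 3 X A (f * g * h) := by
  obtain ⟨p, hp, f, hf, rfl⟩ := hX.2 A hA
  rw [Fin.prod_univ_three] at hp
  exact ⟨f 0, f 1, f 2, hf 0, hf 1, hf 2, hp⟩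

theorem IsFund.isCover (hS : ∀ x, x ∈ S ↔ x ∈ X) {A : Pt} {f g h : BPoly}
    (hf : f.totalDegree = 1) (hg : g.totalDegree = 1) (hh : h.totalDegree = 1)
    (hp : IsFund 3 X A (f * g * h)) :
    IsCover {L | IsLine L} S A {x | eval x f = 0} {x | eval x g = 0} {x | eval x h = 0} := by
  obtain ⟨-, h1, h2⟩ := hp
  simp only [map_mul] at h1 h2
  refine ⟨⟨f, hf, rfl⟩, ⟨g, hg, rfl⟩, ⟨h, hh, rfl⟩, ?_, ?_, ?_, fun B hB hBA => ?_⟩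
  · intro h0
    rw [Set.mem_ofPred_eq] at h0
    simp [h0] at h1
  · intro h0
    rw [Set.mem_ofPred_eq] at h0
    simp [h0] at h1
  · intro h0
    rw [Set.mem_ofPred_eq] at h0
    simp [h0] at h1
  · have := h2 B ((hS B).mp hB) hBA
    rw [mul_eq_zero, mul_eq_zero] at this
    simp only [Set.mem_ofPred_eq]
    tauto

theorem IsGC.isLineSystem (hX : IsGC 3 X) (hS : ∀ x, x ∈ S ↔ x ∈ X) :
    IsLineSystem {L | IsLine L} S where
  eq_of_mem _ hL _ hL' _ _ hxy hx hx' hy hy' := hL.eq_of_mem hL' hxy hx hx' hy hy'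
  card_eq := by
    have hSX : (S : Set Pt) = X := Set.ext hS
    have := hX.1.1
    rw [← hSX, Set.ncard_coe_finset] at this
    simpa using this
  exists_isCover A hA := by
    obtain ⟨f, g, h, hf, hg, hh, hp⟩ := hX.exists_isFund ((hS A).mp hA)
    exact ⟨_, _, _, hp.isCover hS hf hg hh⟩
  exists_notMem a ha b hb c hc := by
    obtain ⟨B, hB, hno⟩ := hX.1.exists_notMem ha hb hc
    exact ⟨B, (hS B).mpr hB, hno⟩

theorem IsGC.uses_iff (hX : IsGC 3 X) (hS : ∀ x, x ∈ S ↔ x ∈ X) {A : Pt} (hA : A ∈ X)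
    {ℓ : Set Pt} : Uses 3 X ℓ A ↔ ∃ b c, IsCover {L | IsLine L} S A ℓ b c := by
  constructor
  · rintro ⟨p, e, hp, he, rfl, hep⟩
    obtain ⟨f, g, h, hf, hg, hh, hp'⟩ := hX.exists_isFund hA
    obtain rfl := hp.unique hX.1 hp'
    have hc := hp'.isCover hS hf hg hh
    obtain ⟨q, hq⟩ := hep
    have hsub : ∀ x ∈ {x | eval x e = 0},
        x ∈ {x | eval x f = 0} ∨ x ∈ {x | eval x g = 0} ∨ x ∈ {x | eval x h = 0} := by
      intro x hx
      simp only [Set.mem_ofPred_eq] at hx ⊢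
      have := congrArg (eval x) hq
      rw [map_mul, map_mul, map_mul, hx, zero_mul, mul_eq_zero, mul_eq_zero] at this
      tauto
    rcases IsLine.eq_of_subset ⟨e, he, rfl⟩ hc.mem_fst hc.mem_snd hc.mem_trd hsub with h' | h' | h'
    all_goals rw [h']
    exacts [⟨_, _, hc⟩, ⟨_, _, hc.swap_fst⟩, ⟨_, _, hc.swap_snd.swap_fst⟩]
  · rintro ⟨b, c, ⟨f, hf, rfl⟩, ⟨g, hg, rfl⟩, ⟨h, hh, rfl⟩, h1, h2, h3, hcov⟩
    simp only [Set.mem_ofPred_eq] at h1 h2 h3 hcov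
    refine ⟨C (eval A (f * g * h))⁻¹ * (f * g * h), f, ⟨?_, ?_, fun B hB hBA => ?_⟩, hf, rfl,
      Dvd.intro_left (C (eval A (f * g * h))⁻¹ * g * h) (by ring)⟩
    · refine (totalDegree_mul _ _).trans ?_
      rw [totalDegree_C, zero_add]
      exact totalDegree_mul_three_le hf hg hh
    · rw [map_mul, eval_C]
      exact inv_mul_cancel₀ (by simp [h1, h2, h3])
    · rw [map_mul, map_mul, map_mul]
      rcases hcov B ((hS B).mpr hB) hBA with h' | h' | h' <;> simp [h']

theorem ncard_inter_eq_card_nodesOn (hS : ∀ x, x ∈ S ↔ x ∈ X) (L : Set Pt) :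
    (X ∩ L).ncard = (nodesOn S L).card := by
  rw [← Set.ncard_coe_finset]
  congr 1
  ext x
  simp [mem_nodesOn, hS]

end GC

/-- For a `GC_3` set `X` and a `3`-node line `ℓ`: `|X_ℓ| = 0` iff `X` has
exactly three maximal lines and they intersect `ℓ` at three distinct nodes of `X`. -/
theorem GC3_useSet_card_eq_zero_iff (X ℓ : Set Pt) (hX : IsGC 3 X)
    (hℓ : IsNodeLine 3 X ℓ) :
    (UseSet 3 X ℓ).ncard = 0 ↔
      ∃ M₁ M₂ M₃ : Set Pt, M₁ ≠ M₂ ∧ M₁ ≠ M₃ ∧ M₂ ≠ M₃ ∧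
        IsMaxLine 3 X M₁ ∧ IsMaxLine 3 X M₂ ∧ IsMaxLine 3 X M₃ ∧
        (∀ M : Set Pt, IsMaxLine 3 X M → M = M₁ ∨ M = M₂ ∨ M = M₃) ∧
        ∃ A₁ A₂ A₃ : Pt, A₁ ≠ A₂ ∧ A₁ ≠ A₃ ∧ A₂ ≠ A₃ ∧
          A₁ ∈ X ∩ ℓ ∩ M₁ ∧ A₂ ∈ X ∩ ℓ ∩ M₂ ∧ A₃ ∈ X ∩ ℓ ∩ M₃ := by
  have hfin : X.Finite := Set.finite_of_ncard_ne_zero (by rw [hX.1.1]; norm_num)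
  obtain ⟨S, rfl⟩ := hfin.exists_finset_coe
  have hS : ∀ x, x ∈ S ↔ x ∈ (S : Set Pt) := fun x => Iff.rfl
  have hcard := ncard_inter_eq_card_nodesOn hS
  have hmax : ∀ M, IsMaxLine 3 S M ↔ M ∈ {L | IsLine L} ∧ (nodesOn S M).card = 4 := by
    intro M
    rw [IsMaxLine, IsNodeLine, hcard]
    rfl
  have hempty : (UseSet 3 S ℓ).ncard = 0 ↔
      ∀ A ∈ S, ∀ b c, ¬ IsCover {L | IsLine L} S A ℓ b c := by
    rw [Set.ncard_eq_zero (hfin.subset fun A hA => hA.1), Set.eq_empty_iff_forall_notMem]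
    refine forall_congr' fun A => ⟨fun h hA b c hc => h ⟨hA, (hX.uses_iff hS hA).mpr ⟨b, c, hc⟩⟩,
      fun h hA => ?_⟩
    obtain ⟨b, c, hc⟩ := (hX.uses_iff hS hA.1).mp hA.2
    exact h hA.1 b c hc
  have hℓ3 := hℓ.2
  rw [hcard] at hℓ3
  rw [hempty, (hX.isLineSystem hS).forall_not_isCover_iff hℓ.1 hℓ3]
  simp only [hmax]
  constructor
  · rintro ⟨M₁, M₂, M₃, A₁, A₂, A₃, t⟩
    exact ⟨M₁, M₂, M₃, t.ne₁₂, t.ne₁₃, t.ne₂₃, ⟨t.mem₁, t.card₁⟩, ⟨t.mem₂, t.card₂⟩,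
      ⟨t.mem₃, t.card₃⟩, fun M hM => t.eq_of_card M hM.1 hM.2, A₁, A₂, A₃, t.pt_ne₁₂, t.pt_ne₁₃,
      t.pt_ne₂₃, ⟨⟨t.pt₁.1, t.pt₁.2.1⟩, t.pt₁.2.2⟩, ⟨⟨t.pt₂.1, t.pt₂.2.1⟩, t.pt₂.2.2⟩,
      ⟨⟨t.pt₃.1, t.pt₃.2.1⟩, t.pt₃.2.2⟩⟩
  · rintro ⟨M₁, M₂, M₃, n₁₂, n₁₃, n₂₃, ⟨h₁, c₁⟩, ⟨h₂, c₂⟩, ⟨h₃, c₃⟩, hall, A₁, A₂, A₃, p₁₂, p₁₃,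
      p₂₃, ⟨⟨x₁, l₁⟩, m₁⟩, ⟨⟨x₂, l₂⟩, m₂⟩, ⟨⟨x₃, l₃⟩, m₃⟩⟩
    exact ⟨M₁, M₂, M₃, A₁, A₂, A₃, hℓ.1, hℓ3, h₁, h₂, h₃, c₁, c₂, c₃, n₁₂, n₁₃, n₂₃,
      fun M hM hM4 => hall M ⟨hM, hM4⟩, p₁₂, p₁₃, p₂₃, ⟨x₁, l₁, m₁⟩, ⟨x₂, l₂, m₂⟩,
      ⟨x₃, l₃, m₃⟩⟩
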